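/- Let δ > 0, k > 0, θ₀ ∈ (0, π/2), N ∈ ℕ, and A, B ∈ ℂ. Let Γ := { t·(cos θ₀, sin θ₀) : t ∈ [0, δ) } ∪ { t·(cos θ₀, −sin θ₀) : t ∈ [0, δ) } ⊆ ℝ². Suppose w, f : ℝ² → ℂ are real-analytic on the open ball B(0, δ), that Δw + k²w = f holds on B(0, δ) (Δ being the sum of the two second partial derivatives), that w(x) = 0 and the total derivative of w vanishes at every point x ∈ Γ, and that f(r·cos θ, r·sin θ) = r^N·(A·cos(Nθ) + B·sin(Nθ)) + o(r^N) as r → 0⁺, uniformly in θ ∈ [0, 2π]. Then A·cos(Nθ) + B·sin(Nθ) = 0 for all θ ∈ ℝ. -/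

import Mathlib

open Real

/-- The Laplacian of a function on `ℝ²`, as the sum of the two second partial derivatives. -/
noncomputable def laplacian2 (w : ℝ × ℝ → ℂ) (x : ℝ × ℝ) : ℂ :=
  fderiv ℝ (fun y => fderiv ℝ w y (1, 0)) x (1, 0)
    + fderiv ℝ (fun y => fderiv ℝ w y (0, 1)) x (0, 1)

/-- The two boundary rays (of length `δ`) of a corner with half-opening angle `θ₀`. -/
def cornerRays (δ θ₀ : ℝ) : Set (ℝ × ℝ) :=
  {p | ∃ t : ℝ, 0 ≤ t ∧ t < δ ∧ p = (t * Real.cos θ₀, t * Real.sin θ₀)} ∪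
  {p | ∃ t : ℝ, 0 ≤ t ∧ t < δ ∧ p = (t * Real.cos θ₀, -(t * Real.sin θ₀))}

open Complex (I)
open Filter Topology Asymptotics Finset

/-- The first-order operator `∂₁ + s ∂₂`; `s = -I` and `s = I` give twice the Wirtinger
derivatives. -/
noncomputable def wirtinger (s : ℂ) (g : ℝ × ℝ → ℂ) (x : ℝ × ℝ) : ℂ :=
  fderiv ℝ g x (1, 0) + s * fderiv ℝ g x (0, 1)

/-- A doubly indexed family of functions, analytic on `U`, in which `wirtinger (-I)` raises the
first index and `wirtinger I` raises the second one. -/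
structure IsWirtingerFamily (U : Set (ℝ × ℝ)) (c : ℕ → ℕ → ℝ × ℝ → ℂ) : Prop where
  analytic : ∀ a b, AnalyticOnNhd ℝ (c a b) U
  left : ∀ a b, ∀ x ∈ U, wirtinger (-I) (c a b) x = c (a + 1) b x
  right : ∀ a b, ∀ x ∈ U, wirtinger I (c a b) x = c a (b + 1) x

theorem analyticOnNhd_wirtinger {U : Set (ℝ × ℝ)} {g : ℝ × ℝ → ℂ} (hg : AnalyticOnNhd ℝ g U)
    (s : ℂ) : AnalyticOnNhd ℝ (wirtinger s g) U := by
  intro x hx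
  have h := (hg x hx).fderiv
  have h1 : ∀ v : ℝ × ℝ, AnalyticAt ℝ (fun y => fderiv ℝ g y v) x := fun v =>
    ((ContinuousLinearMap.apply ℝ ℂ v).analyticAt _).comp h
  exact (h1 _).add (analyticAt_const.mul (h1 _))

theorem wirtinger_congr {U : Set (ℝ × ℝ)} (hU : IsOpen U) {g h : ℝ × ℝ → ℂ}
    (hgh : ∀ x ∈ U, g x = h x) (s : ℂ) {x : ℝ × ℝ} (hx : x ∈ U) :
    wirtinger s g x = wirtinger s h x := by
  have : g =ᶠ[𝓝 x] h := by
    filter_upwards [hU.mem_nhds hx] with y hy using hgh y hy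
  simp only [wirtinger, this.fderiv_eq]

theorem wirtinger_wirtinger {g : ℝ × ℝ → ℂ} {x : ℝ × ℝ} (hg : AnalyticAt ℝ g x) (s t : ℂ) :
    wirtinger s (wirtinger t g) x =
      fderiv ℝ (fun y => fderiv ℝ g y (1, 0)) x (1, 0)
        + (s + t) * fderiv ℝ (fun y => fderiv ℝ g y (1, 0)) x (0, 1)
        + s * t * fderiv ℝ (fun y => fderiv ℝ g y (0, 1)) x (0, 1) := by
  have h := hg.fderiv.differentiableAt
  have h1 : ∀ v : ℝ × ℝ, HasFDerivAt (fun y => fderiv ℝ g y v)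
      ((fderiv ℝ (fderiv ℝ g) x).flip v) x := fun v => by
    simpa using! h.hasFDerivAt.clm_apply (hasFDerivAt_const v x)
  have hsymm : fderiv ℝ (fderiv ℝ g) x (1, 0) (0, 1) = fderiv ℝ (fderiv ℝ g) x (0, 1) (1, 0) :=
    (hg.contDiffAt (n := ⊤)).isSymmSndFDerivAt_of_omega (1, 0) (0, 1)
  have h2 : HasFDerivAt (wirtinger t g) ((fderiv ℝ (fderiv ℝ g) x).flip (1, 0)
      + t • (fderiv ℝ (fderiv ℝ g) x).flip (0, 1)) x :=
    (h1 _).add ((h1 _).const_mul t)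
  rw [wirtinger, h2.fderiv, (h1 _).fderiv, (h1 _).fderiv]
  simp only [add_apply, smul_apply,
    ContinuousLinearMap.flip_apply, hsymm, smul_eq_mul]
  ring

theorem wirtinger_comm {g : ℝ × ℝ → ℂ} {x : ℝ × ℝ} (hg : AnalyticAt ℝ g x) (s t : ℂ) :
    wirtinger s (wirtinger t g) x = wirtinger t (wirtinger s g) x := by
  rw [wirtinger_wirtinger hg, wirtinger_wirtinger hg, add_comm s t, mul_comm s t]

theorem wirtinger_add_const_mul {g h : ℝ × ℝ → ℂ} {x : ℝ × ℝ} (hg : AnalyticAt ℝ g x)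
    (hh : AnalyticAt ℝ h x) (s K : ℂ) :
    wirtinger s (fun y => g y + K * h y) x = wirtinger s g x + K * wirtinger s h x := by
  have : HasFDerivAt (fun y => g y + K * h y) (fderiv ℝ g x + K • fderiv ℝ h x) x :=
    hg.differentiableAt.hasFDerivAt.add (hh.differentiableAt.hasFDerivAt.const_mul K)
  simp only [wirtinger, this.fderiv, add_apply, smul_apply,
    smul_eq_mul]
  ring

/-- The family of iterated Wirtinger derivatives of a function. -/
noncomputable def wirtingerIterate (g : ℝ × ℝ → ℂ) (a b : ℕ) : ℝ × ℝ → ℂ :=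
  (wirtinger (-I))^[a] ((wirtinger I)^[b] g)

theorem isWirtingerFamily_iterate {U : Set (ℝ × ℝ)} (hU : IsOpen U) {g : ℝ × ℝ → ℂ}
    (hg : AnalyticOnNhd ℝ g U) : IsWirtingerFamily U (wirtingerIterate g) := by
  have hleft : ∀ a b, wirtingerIterate g (a + 1) b = wirtinger (-I) (wirtingerIterate g a b) :=
    fun a b => Function.iterate_succ_apply' _ _ _
  have hright : ∀ b, wirtingerIterate g 0 (b + 1) = wirtinger I (wirtingerIterate g 0 b) :=
    fun b => Function.iterate_succ_apply' _ _ _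
  have han : ∀ a b, AnalyticOnNhd ℝ (wirtingerIterate g a b) U := by
    intro a b
    induction a with
    | zero =>
      induction b with
      | zero => exact hg
      | succ b ih => exact hright b ▸ analyticOnNhd_wirtinger ih _
    | succ a ih => exact hleft a b ▸ analyticOnNhd_wirtinger ih _
  refine ⟨han, fun a b x _ => by rw [hleft], fun a b => ?_⟩
  induction a with
  | zero => exact fun x _ => by rw [hright]
  | succ a ih =>
    intro x hx
    rw [hleft, hleft, wirtinger_comm (han a b x hx)]
    exact wirtinger_congr hU ih _ hx

namespace IsWirtingerFamily

variable {U : Set (ℝ × ℝ)} {c : ℕ → ℕ → ℝ × ℝ → ℂ}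

theorem shift (hc : IsWirtingerFamily U c) (i j : ℕ) :
    IsWirtingerFamily U fun a b => c (a + i) (b + j) :=
  ⟨fun _ _ => hc.analytic _ _, fun a b x hx => by rw [hc.left _ _ x hx, Nat.add_right_comm],
    fun a b x hx => by rw [hc.right _ _ x hx, Nat.add_right_comm]⟩

theorem add_const_mul {d : ℕ → ℕ → ℝ × ℝ → ℂ} (hc : IsWirtingerFamily U c)
    (hd : IsWirtingerFamily U d) (K : ℂ) :
    IsWirtingerFamily U fun a b x => c a b x + K * d a b x := by
  refine ⟨fun a b x hx => (hc.analytic a b x hx).add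
    (analyticAt_const.mul (hd.analytic a b x hx)), fun a b x hx => ?_, fun a b x hx => ?_⟩
  · rw [wirtinger_add_const_mul (hc.analytic a b x hx) (hd.analytic a b x hx),
      hc.left _ _ x hx, hd.left _ _ x hx]
  · rw [wirtinger_add_const_mul (hc.analytic a b x hx) (hd.analytic a b x hx),
      hc.right _ _ x hx, hd.right _ _ x hx]

/-- The derivative of a member of the family along a line. -/
theorem hasDerivAt_line (hc : IsWirtingerFamily U c) (p q : ℝ) {t : ℝ}
    (ht : (t * p, t * q) ∈ U) (a b : ℕ) :
    HasDerivAt (fun t : ℝ => c a b (t * p, t * q))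
      ((p + q * I) / 2 * c (a + 1) b (t * p, t * q)
        + (p - q * I) / 2 * c a (b + 1) (t * p, t * q)) t := by
  have hline : HasDerivAt (fun t : ℝ => (t * p, t * q)) (p, q) t := by
    simpa using ((hasDerivAt_id t).mul_const p).prodMk ((hasDerivAt_id t).mul_const q)
  have h := (hc.analytic a b _ ht).differentiableAt.hasFDerivAt.comp_hasDerivAt t hline
  refine h.congr_deriv ?_
  rw [← hc.left a b _ ht, ← hc.right a b _ ht, wirtinger, wirtinger]
  have hpq : ((p, q) : ℝ × ℝ) = p • (1, 0) + q • (0, 1) := by simp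
  rw [hpq, map_add, map_smul, map_smul, Complex.real_smul, Complex.real_smul]
  linear_combination ((q : ℂ) * fderiv ℝ (c a b) (t * p, t * q) (0, 1)) * Complex.I_sq

/-- The coefficients of the restriction of the family to a line. -/
noncomputable def lineSum (c : ℕ → ℕ → ℝ × ℝ → ℂ) (p q : ℝ) (n : ℕ) (t : ℝ) : ℂ :=
  ∑ ij ∈ antidiagonal n, (n.choose ij.1 : ℂ) *
    (((p + q * I) / 2) ^ ij.1 * ((p - q * I) / 2) ^ ij.2 * c ij.1 ij.2 (t * p, t * q))

theorem hasDerivAt_lineSum (hc : IsWirtingerFamily U c) (p q : ℝ) {t : ℝ}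
    (ht : (t * p, t * q) ∈ U) (n : ℕ) :
    HasDerivAt (lineSum c p q n) (lineSum c p q (n + 1) t) t := by
  rw [lineSum, Finset.sum_antidiagonal_choose_succ_mul (R := ℂ) (fun i j =>
    ((p + q * I) / 2) ^ i * ((p - q * I) / 2) ^ j * c i j (t * p, t * q)), ← sum_add_distrib]
  refine HasDerivAt.fun_sum fun ij hij => ?_
  have h := ((hc.hasDerivAt_line p q ht ij.1 ij.2).const_mul
    (((p + q * I) / 2) ^ ij.1 * ((p - q * I) / 2) ^ ij.2)).const_mul (n.choose ij.1 : ℂ)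
  rw [n.choose_symm_of_eq_add (mem_antidiagonal.1 hij).symm] at h ⊢
  exact h.congr_deriv (by ring)

end IsWirtingerFamily

/-- The Taylor coefficients up to order `N` of a function that is `h t ^ N + o(t ^ N)` on the
right of `0`. -/
theorem iteratedDeriv_of_isLittleO_nhdsGT {φ : ℝ → ℂ} (hφ : AnalyticAt ℝ φ 0) (N : ℕ) (h : ℂ)
    (ho : (fun t : ℝ => φ t - (t : ℂ) ^ N * h) =o[𝓝[>] 0] fun t : ℝ => t ^ N) {n : ℕ}
    (hn : n ≤ N) : iteratedDeriv n φ 0 = if n = N then (N.factorial : ℂ) * h else 0 := by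
  have hpow : AnalyticAt ℝ (fun t : ℝ => t ^ N • h) 0 := by fun_prop
  have hψ : AnalyticAt ℝ (fun t : ℝ => φ t - t ^ N • h) 0 := hφ.sub hpow
  have hord : ((N + 1 : ℕ) : ℕ∞) ≤ analyticOrderAt (fun t : ℝ => φ t - t ^ N • h) 0 := by
    by_contra hlt
    rw [not_le] at hlt
    obtain ⟨m, hm⟩ := ENat.ne_top_iff_exists.1 hlt.ne_top
    rw [← hm, Nat.cast_lt] at hlt
    obtain ⟨g, hg, hg0, hgeq⟩ := (hψ.analyticOrderAt_eq_natCast).1 hm.symm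
    apply hg0
    have ho' : (fun t : ℝ => t ^ m • g t) =o[𝓝[>] 0] fun t : ℝ => t ^ m := by
      have hle : (fun t : ℝ => t ^ N) =O[𝓝[>] 0] fun t : ℝ => t ^ m := by
        rcases (Nat.lt_succ_iff.1 hlt).eq_or_lt with rfl | hmN
        · exact isBigO_refl _ _
        · exact (isLittleO_pow_pow hmN).isBigO.mono nhdsWithin_le_nhds
      refine (ho.trans_isBigO hle).congr' ?_ EventuallyEq.rfl
      filter_upwards [nhdsWithin_le_nhds hgeq] with t ht
      simpa using ht
    have hgo : Tendsto g (𝓝[>] 0) (𝓝 0) := by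
      rw [← isLittleO_one_iff ℝ]
      have := (isBigO_refl (fun t : ℝ => (t ^ m)⁻¹) (𝓝[>] 0)).smul_isLittleO ho'
      refine this.congr' ?_ ?_
      all_goals
        filter_upwards [self_mem_nhdsWithin] with t ht
        have : t ^ m ≠ 0 := pow_ne_zero _ (ne_of_gt ht)
      · rw [inv_smul_smul₀ this]
      · simp [this]
    exact tendsto_nhds_unique (hg.continuousAt.tendsto.mono_left nhdsWithin_le_nhds) hgo
  have hz := (natCast_le_analyticOrderAt_iff_iteratedDeriv_eq_zero hψ).1 hord n (by lia)
  rw [iteratedDeriv_fun_sub hφ.contDiffAt hpow.contDiffAt, sub_eq_zero] at hz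
  rw [hz]
  simp (disch := fun_prop) only [iteratedDeriv_smul_const, iteratedDeriv_fun_pow_zero]
  split_ifs with hnN <;> simp_all

theorem iteratedDeriv_eventuallyEq {φ : ℕ → ℝ → ℂ}
    (hφ : ∀ n, ∀ᶠ t in 𝓝 0, HasDerivAt (φ n) (φ (n + 1) t) t) (n : ℕ) :
    iteratedDeriv n (φ 0) =ᶠ[𝓝 0] φ n := by
  induction n with
  | zero => simp [EventuallyEq.refl]
  | succ n ih =>
    rw [iteratedDeriv_succ]
    filter_upwards [ih.deriv, hφ n] with t h1 h2
    rw [h1, h2.deriv]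

theorem IsWirtingerFamily.lineSum_zero {U : Set (ℝ × ℝ)} (hU : U ∈ 𝓝 0)
    {c : ℕ → ℕ → ℝ × ℝ → ℂ} (hc : IsWirtingerFamily U c) (p q : ℝ) (N : ℕ) (h : ℂ)
    (ho : (fun t : ℝ => c 0 0 (t * p, t * q) - (t : ℂ) ^ N * h) =o[𝓝[>] 0] fun t : ℝ => t ^ N)
    {n : ℕ} (hn : n ≤ N) :
    ∑ ij ∈ antidiagonal n, (n.choose ij.1 : ℂ) *
      (((p + q * I) / 2) ^ ij.1 * ((p - q * I) / 2) ^ ij.2 * c ij.1 ij.2 0) =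
      if n = N then (N.factorial : ℂ) * h else 0 := by
  have hline : ∀ᶠ t : ℝ in 𝓝 0, (t * p, t * q) ∈ U := by
    have : ContinuousAt (fun t : ℝ => (t * p, t * q)) 0 := by fun_prop
    exact this.preimage_mem_nhds (by simpa [Prod.zero_eq_mk] using hU)
  have h0 : lineSum c p q 0 = fun t : ℝ => c 0 0 (t * p, t * q) := by
    ext t; simp [lineSum]
  have han : AnalyticAt ℝ (lineSum c p q 0) 0 := by
    rw [h0]
    refine AnalyticAt.fun_comp (g := c 0 0) (f := fun t : ℝ => (t * p, t * q)) ?_ (by fun_prop)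
    exact hc.analytic 0 0 _ (by simpa [Prod.zero_eq_mk] using mem_of_mem_nhds hU)
  rw [← iteratedDeriv_of_isLittleO_nhdsGT han N h (by simpa only [h0] using ho) hn,
    (iteratedDeriv_eventuallyEq (fun n => hline.mono fun t ht =>
      hc.hasDerivAt_lineSum p q ht n) n).eq_of_nhds]
  simp [lineSum, Prod.zero_eq_mk]

/-- A homogeneous trigonometric polynomial that vanishes for all angles has zero coefficients. -/
theorem trig_coeff_eq_zero {n : ℕ} {v : ℕ → ℂ}
    (h : ∀ θ : ℝ, ∑ ij ∈ antidiagonal n, v ij.1 *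
      ((Real.cos θ + Real.sin θ * I) ^ ij.1 * (Real.cos θ - Real.sin θ * I) ^ ij.2) = 0)
    {i : ℕ} (hi : i ≤ n) : v i = 0 := by
  set P : Polynomial ℂ := ∑ i ∈ range (n + 1), Polynomial.monomial i (v i) with hP
  have hroot : ∀ θ : ℝ, P.eval (Complex.exp ((2 * θ : ℝ) * I)) = 0 := by
    intro θ
    have h1 : (Real.cos θ + Real.sin θ * I : ℂ) = Complex.exp (θ * I) := by
      simp [Complex.exp_mul_I]
    have h2 : (Real.cos θ - Real.sin θ * I : ℂ) = Complex.exp (-(θ * I)) := by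
      rw [← neg_mul, Complex.exp_mul_I]; simp [sub_eq_add_neg]
    have h3 := congrArg (Complex.exp (θ * I) ^ n * ·) (h θ)
    simp only [mul_zero, h1, h2, mul_sum] at h3
    rw [← h3, hP, Polynomial.eval_finsetSum,
      Finset.Nat.sum_antidiagonal_eq_sum_range_succ_mk]
    refine sum_congr rfl fun i hi => ?_
    obtain ⟨j, rfl⟩ := Nat.exists_eq_add_of_le (Nat.lt_succ_iff.1 (mem_range.1 hi))
    have h4 : Complex.exp (θ * I) ^ j * Complex.exp (-(θ * I)) ^ j = 1 := by
      rw [← mul_pow, ← Complex.exp_add, add_neg_cancel, Complex.exp_zero, one_pow]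
    have h5 : Complex.exp ((2 * θ : ℝ) * I) = Complex.exp (θ * I) ^ 2 := by
      rw [← Complex.exp_nat_mul]; congr 1; push_cast; ring
    rw [Polynomial.eval_monomial, h5, Nat.add_sub_cancel_left, pow_add]
    linear_combination (-v i * Complex.exp (θ * I) ^ i * Complex.exp (θ * I) ^ i) * h4
  have hP0 : P = 0 := by
    refine Polynomial.eq_zero_of_infinite_isRoot P (Set.Infinite.mono
      (s := (fun θ : ℝ => Complex.exp ((2 * θ : ℝ) * I)) '' Set.Icc 0 1) ?_ ?_)
    · rintro _ ⟨θ, -, rfl⟩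
      exact hroot θ
    · refine (Set.Icc_infinite one_pos).image ?_
      intro x hx y hy hxy
      have hpi := Real.pi_gt_three
      have him : ∀ z : ℝ, (((2 * z : ℝ) : ℂ) * I).im = 2 * z := fun z => by simp
      have := Complex.exp_inj_of_neg_pi_lt_of_le_pi (by rw [him]; linarith [hx.1])
        (by rw [him]; linarith [hx.2]) (by rw [him]; linarith [hy.1])
        (by rw [him]; linarith [hy.2]) hxy
      have := congrArg Complex.im this
      rw [him, him] at this
      linarith
  have := congrArg (Polynomial.coeff · i) hP0
  simpa [hP, Polynomial.finsetSum_coeff, Polynomial.coeff_monomial, Nat.lt_succ_iff, hi]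
    using this

theorem abs_sin_nat_mul_le (n : ℕ) (x : ℝ) : |Real.sin (n * x)| ≤ n * |Real.sin x| := by
  induction n with
  | zero => simp
  | succ n ih =>
    push_cast
    rw [add_mul, one_mul, Real.sin_add]
    calc |Real.sin (n * x) * Real.cos x + Real.cos (n * x) * Real.sin x|
        ≤ |Real.sin (n * x)| * |Real.cos x| + |Real.cos (n * x)| * |Real.sin x| := by
          rw [← abs_mul, ← abs_mul]; exact abs_add_le _ _
      _ ≤ |Real.sin (n * x)| * 1 + 1 * |Real.sin x| := by
          gcongr
          · exact Real.abs_cos_le_one _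
          · exact Real.abs_cos_le_one _
      _ ≤ (n + 1) * |Real.sin x| := by linarith

theorem abs_sin_nat_mul_lt {n : ℕ} (hn : 2 ≤ n) {x : ℝ} (hx : Real.sin x ≠ 0) :
    |Real.sin (n * x)| < n * |Real.sin x| := by
  obtain ⟨m, rfl⟩ := Nat.exists_eq_add_of_le' hn
  have hs : 0 < |Real.sin x| := abs_pos.2 hx
  have hc : |Real.cos x| < 1 := by
    rw [← sq_lt_one_iff_abs_lt_one]
    nlinarith [Real.sin_sq_add_cos_sq x, sq_pos_of_ne_zero hx]
  have hle := abs_sin_nat_mul_le (m + 1) x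
  rw [show ((m + 2 : ℕ) : ℝ) * x = ((m + 1 : ℕ) : ℝ) * x + x by push_cast; ring, Real.sin_add]
  push_cast at hle ⊢
  calc |Real.sin ((m + 1) * x) * Real.cos x + Real.cos ((m + 1) * x) * Real.sin x|
      ≤ |Real.sin ((m + 1) * x)| * |Real.cos x| + |Real.cos ((m + 1) * x)| * |Real.sin x| := by
        rw [← abs_mul, ← abs_mul]; exact abs_add_le _ _
    _ ≤ (m + 1) * |Real.sin x| * |Real.cos x| + 1 * |Real.sin x| := by
        gcongr
        exact Real.abs_cos_le_one _
    _ < (m + 1) * |Real.sin x| * 1 + 1 * |Real.sin x| := by gcongr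
    _ = (m + 2) * |Real.sin x| := by ring

/-- The boundary relation in degree `N + 2`, when only the four extremal coefficients survive. -/
theorem extremal_coeff_relation {c : ℕ → ℕ → ℂ} {N : ℕ}
    (hc : ∀ a b, a + b = N → a ≠ 0 → b ≠ 0 → c (a + 1) (b + 1) = 0) {p q : ℂ} (hpq : p * q = 1)
    (h : ∑ ij ∈ antidiagonal (N + 1), ((N + 1).choose ij.1 : ℂ) *
      ((p / 2) ^ ij.1 * (q / 2) ^ ij.2 * c (ij.1 + 1) ij.2) = 0) (hN : N ≠ 0) :
    c (N + 2) 0 + (N + 1) * q ^ 2 * c (N + 1) 1 + q ^ (2 * N + 2) * c 1 (N + 1) = 0 := by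
  obtain ⟨M, rfl⟩ := Nat.exists_eq_succ_of_ne_zero hN
  rw [Nat.succ_eq_add_one] at *
  rw [Finset.Nat.sum_antidiagonal_succ, Finset.Nat.sum_antidiagonal_succ',
    sum_eq_single (M, 0)] at h
  · have hp : ∀ n : ℕ, p ^ n * q ^ n = 1 := fun n => by rw [← mul_pow, hpq, one_pow]
    simp only [Nat.choose_zero_right, Nat.choose_self, Nat.cast_one, pow_zero, zero_add, div_pow,
      Nat.choose_succ_self_right, pow_one, one_mul, mul_one] at h
    push_cast at h ⊢
    have h2 : (2 : ℂ) ^ (M + 2) ≠ 0 := pow_ne_zero _ two_ne_zero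
    have h' : q ^ (M + 2) * c 1 (M + 2) + p ^ (M + 2) * c (M + 3) 0
        + (M + 2) * p ^ (M + 1) * q * c (M + 2) 1 = 0 := by
      apply mul_left_cancel₀ h2
      field_simp at h
      linear_combination h
    linear_combination q ^ (M + 2) * h' - c (M + 3) 0 * hp (M + 2)
      - (M + 2) * q ^ 2 * c (M + 2) 1 * hp (M + 1)
  · rintro ⟨i, j⟩ hij hne
    rw [HasAntidiagonal.mem_antidiagonal] at hij
    simp only at hij ⊢
    have hj : j ≠ 0 := by
      rintro rfl
      exact hne (by simp_all)
    rw [hc (i + 1) j (by lia) (by lia) hj]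
    simp
  · simp

/-- The coefficients of degree less than `N + 2` vanish. -/
theorem low_coeff_eq_zero {c : ℕ → ℕ → ℂ} {K : ℂ} {N : ℕ} {p q : ℂ} (hp : p ≠ 0) (hq : q ≠ 0)
    (h0 : c 0 0 = 0)
    (hleft : ∀ n, ∑ ij ∈ antidiagonal n, (n.choose ij.1 : ℂ) *
      ((p / 2) ^ ij.1 * (q / 2) ^ ij.2 * c (ij.1 + 1) ij.2) = 0)
    (hright : ∀ n, ∑ ij ∈ antidiagonal n, (n.choose ij.1 : ℂ) *
      ((p / 2) ^ ij.1 * (q / 2) ^ ij.2 * c ij.1 (ij.2 + 1)) = 0)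
    (hlow : ∀ a b, a + b < N → c (a + 1) (b + 1) + K * c a b = 0) (m : ℕ) (hm : m < N + 2) :
    ∀ a b, a + b = m → c a b = 0 := by
  induction m using Nat.strong_induction_on with
  | _ m ih =>
    have hmid : ∀ a b, a + 1 + (b + 1) = m → c (a + 1) (b + 1) = 0 := by
      intro a b hab
      have := hlow a b (by lia)
      rwa [ih (a + b) (by lia) (by lia) a b rfl, mul_zero, add_zero] at this
    rcases m with _ | n
    · intro a b hab
      obtain ⟨rfl, rfl⟩ : a = 0 ∧ b = 0 := by lia
      exact h0
    intro a b hab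
    rcases a with _ | a
    · obtain rfl : b = n + 1 := by lia
      have := hright n
      rw [sum_eq_single (0, n)] at this
      · simpa [hq] using this
      · rintro ⟨i, j⟩ hij hne
        rw [HasAntidiagonal.mem_antidiagonal] at hij
        simp only at hij ⊢
        rcases i with _ | i
        · exact absurd (by simp_all) hne
        · rw [hmid i j (by lia)]; simp
      · simp
    rcases b with _ | b
    · obtain rfl : a = n := by lia
      have := hleft a
      rw [sum_eq_single (a, 0)] at this
      · simpa [hp] using this
      · rintro ⟨i, j⟩ hij hne
        rw [HasAntidiagonal.mem_antidiagonal] at hij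
        simp only at hij ⊢
        rcases j with _ | j
        · exact absurd (by simp_all) hne
        · rw [hmid i j (by lia)]; simp
      · simp
    · exact hmid a b (by lia)

theorem top_coeff_eq_zero {c : ℕ → ℕ → ℂ} {N : ℕ} {θ : ℝ} (hθ : 0 < θ) (hθ' : θ < π / 2)
    (hc : ∀ a b, a + b = N → a ≠ 0 → b ≠ 0 → c (a + 1) (b + 1) = 0)
    {p q : ℂ} (hp : p = Complex.exp (θ * I)) (hq : q = Complex.exp (-(θ * I)))
    (h₁ : ∑ ij ∈ antidiagonal (N + 1), ((N + 1).choose ij.1 : ℂ) *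
      ((p / 2) ^ ij.1 * (q / 2) ^ ij.2 * c (ij.1 + 1) ij.2) = 0)
    (h₂ : ∑ ij ∈ antidiagonal (N + 1), ((N + 1).choose ij.1 : ℂ) *
      ((q / 2) ^ ij.1 * (p / 2) ^ ij.2 * c (ij.1 + 1) ij.2) = 0)
    (h₃ : ∑ ij ∈ antidiagonal (N + 1), ((N + 1).choose ij.1 : ℂ) *
      ((p / 2) ^ ij.1 * (q / 2) ^ ij.2 * c ij.1 (ij.2 + 1)) = 0)
    (h₄ : ∑ ij ∈ antidiagonal (N + 1), ((N + 1).choose ij.1 : ℂ) *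
      ((q / 2) ^ ij.1 * (p / 2) ^ ij.2 * c ij.1 (ij.2 + 1)) = 0)
    {a b : ℕ} (hab : a + b = N) : c (a + 1) (b + 1) = 0 := by
  have hpq : p * q = 1 := by rw [hp, hq, ← Complex.exp_add, add_neg_cancel, Complex.exp_zero]
  have hqp : q * p = 1 := by rw [mul_comm, hpq]
  have hsin : Real.sin (2 * θ) ≠ 0 :=
    (Real.sin_pos_of_pos_of_lt_pi (by linarith) (by linarith)).ne'
  have hdiff : ∀ n : ℕ, p ^ (2 * n) - q ^ (2 * n) = Real.sin (n * (2 * θ)) * (2 * I) := by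
    intro n
    rw [hp, hq, ← Complex.exp_nat_mul, ← Complex.exp_nat_mul, Complex.ofReal_sin, Complex.sin]
    push_cast
    rw [show (2 * n : ℂ) * (θ * I) = n * (2 * θ) * I by ring,
      show (2 * n : ℂ) * -(θ * I) = -(n * (2 * θ)) * I by ring]
    linear_combination (Complex.exp (n * (2 * θ) * I) - Complex.exp (-(n * (2 * θ)) * I))
      * Complex.I_sq
  have hdiff1 : p ^ 2 - q ^ 2 = Real.sin (2 * θ) * (2 * I) := by simpa using hdiff 1
  have h2I : (2 * I : ℂ) ≠ 0 := by simp
  rcases eq_or_ne N 0 with rfl | hN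
  · obtain ⟨rfl, rfl⟩ : a = 0 ∧ b = 0 := by lia
    simp only [Finset.Nat.sum_antidiagonal_succ, Finset.Nat.antidiagonal_zero,
      sum_singleton] at h₁ h₂
    simp only [zero_add, Nat.choose_zero_right, Nat.choose_self, pow_zero, pow_one] at h₁ h₂
    have : (p ^ 2 - q ^ 2) * c 1 1 = 0 := by
      linear_combination 2 * p * h₂ - 2 * q * h₁
    rw [hdiff1] at this
    exact (mul_eq_zero.1 this).resolve_left (mul_ne_zero (Complex.ofReal_ne_zero.2 hsin) h2I)
  have swap : ∀ {p q : ℂ}, ∑ ij ∈ antidiagonal (N + 1), ((N + 1).choose ij.1 : ℂ) *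
      ((p / 2) ^ ij.1 * (q / 2) ^ ij.2 * c ij.1 (ij.2 + 1)) = 0 →
      ∑ ij ∈ antidiagonal (N + 1), ((N + 1).choose ij.1 : ℂ) *
      ((q / 2) ^ ij.1 * (p / 2) ^ ij.2 * c ij.2 (ij.1 + 1)) = 0 := by
    intro p q h
    rw [← Finset.Nat.sum_antidiagonal_swap, ← h]
    refine sum_congr rfl fun ij hij => ?_
    rw [Nat.choose_symm_of_eq_add (HasAntidiagonal.mem_antidiagonal.1 hij).symm]
    simp only [Prod.fst_swap, Prod.snd_swap]
    ring
  have hc' : ∀ a b, a + b = N → a ≠ 0 → b ≠ 0 → c (b + 1) (a + 1) = 0 :=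
    fun a b h ha hb => hc b a (by lia) hb ha
  have e₁ := extremal_coeff_relation hc hpq h₁ hN
  have e₂ := extremal_coeff_relation hc hqp h₂ hN
  have e₃ := extremal_coeff_relation (c := fun a b => c b a) hc' hqp (swap h₃) hN
  have e₄ := extremal_coeff_relation (c := fun a b => c b a) hc' hpq (swap h₄) hN
  have hT := hdiff (N + 1)
  rw [mul_add, mul_one] at hT
  set S := Real.sin (2 * θ)
  set T := Real.sin ((N + 1 : ℕ) * (2 * θ))
  have hST : ((N + 1) * S : ℂ) ^ 2 - (T : ℂ) ^ 2 ≠ 0 := by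
    have hlt : |T| < (N + 1 : ℕ) * |S| := abs_sin_nat_mul_lt (by lia) hsin
    have : T ^ 2 < (((N + 1 : ℕ) : ℝ) * S) ^ 2 := by
      rw [sq_lt_sq, abs_mul, Nat.abs_cast]; exact hlt
    have h := (sub_pos.2 this).ne'
    exact_mod_cast h
  have f₁ : (N + 1) * S * c (N + 1) 1 + T * c 1 (N + 1) = 0 := by
    apply mul_right_cancel₀ h2I
    linear_combination e₂ - e₁ - (N + 1) * c (N + 1) 1 * hdiff1 - c 1 (N + 1) * hT
  have f₂ : (N + 1) * S * c 1 (N + 1) + T * c (N + 1) 1 = 0 := by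
    apply mul_right_cancel₀ h2I
    linear_combination e₃ - e₄ - (N + 1) * c 1 (N + 1) * hdiff1 - c (N + 1) 1 * hT
  rcases eq_or_ne a 0 with rfl | ha
  · obtain rfl : b = N := by lia
    refine (mul_eq_zero.1 (?_ : (((b + 1) * S : ℂ) ^ 2 - (T : ℂ) ^ 2) * _ = 0)).resolve_left hST
    linear_combination (b + 1) * S * f₂ - T * f₁
  rcases eq_or_ne b 0 with rfl | hb
  · obtain rfl : a = N := by lia
    refine (mul_eq_zero.1 (?_ : (((a + 1) * S : ℂ) ^ 2 - (T : ℂ) ^ 2) * _ = 0)).resolve_left hST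
    linear_combination (a + 1) * S * f₁ - T * f₂
  exact hc a b hab ha hb

theorem isLittleO_of_forall_bound {φ : ℝ → ℂ} {N : ℕ}
    (h : ∀ ε : ℝ, 0 < ε → ∃ r₀ : ℝ, 0 < r₀ ∧ ∀ r : ℝ, 0 < r → r < r₀ → ‖φ r‖ ≤ ε * r ^ N) :
    φ =o[𝓝[>] 0] fun t : ℝ => t ^ N := by
  rw [isLittleO_iff]
  intro ε hε
  obtain ⟨r₀, hr₀, hr⟩ := h ε hε
  filter_upwards [Ioo_mem_nhdsGT hr₀] with r hr'
  rw [Real.norm_of_nonneg (pow_nonneg hr'.1.le N)]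
  exact hr r hr'.1 hr'.2

theorem cos_sin_nat_mul_eq (A B : ℂ) (N : ℕ) (θ : ℝ) :
    A * (Real.cos (N * θ) : ℂ) + B * (Real.sin (N * θ) : ℂ) =
      (A - B * I) / 2 * (Real.cos θ + Real.sin θ * I) ^ N
        + (A + B * I) / 2 * (Real.cos θ - Real.sin θ * I) ^ N := by
  have h1 : (Real.cos θ + Real.sin θ * I : ℂ) ^ N = Real.cos (N * θ) + Real.sin (N * θ) * I := by
    push_cast
    exact Complex.cos_add_sin_mul_I_pow N θ
  have h2 : (Real.cos θ - Real.sin θ * I : ℂ) ^ N = Real.cos (N * θ) - Real.sin (N * θ) * I := by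
    have := Complex.cos_add_sin_mul_I_pow N (-θ)
    push_cast
    simpa [sub_eq_add_neg] using this
  rw [h1, h2]
  linear_combination (B * (Real.sin (N * θ) : ℂ)) * Complex.I_sq

/-- Local core of Lemma 3.4: if `w` is real-analytic near the corner, solves
`Δw + k²w = f` there, has vanishing Cauchy data on the two boundary rays, and
`f(r cos θ, r sin θ) = r^N (A cos Nθ + B sin Nθ) + o(r^N)` uniformly in `θ`,
then the lowest-order harmonic term of `f` vanishes identically. -/
theorem corner_lowest_harmonic_vanishes (δ k θ₀ : ℝ) (hδ : 0 < δ) (hk : 0 < k)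
    (hθ₀ : 0 < θ₀) (hθ₀' : θ₀ < π / 2) (N : ℕ) (A B : ℂ) (w f : ℝ × ℝ → ℂ)
    (hw : AnalyticOnNhd ℝ w (Metric.ball 0 δ))
    (hf : AnalyticOnNhd ℝ f (Metric.ball 0 δ))
    (heq : ∀ x ∈ Metric.ball (0 : ℝ × ℝ) δ, laplacian2 w x + (k : ℂ) ^ 2 * w x = f x)
    (hbc : ∀ x ∈ cornerRays δ θ₀, w x = 0 ∧ fderiv ℝ w x = 0)
    (hasym : ∀ ε : ℝ, 0 < ε → ∃ r₀ : ℝ, 0 < r₀ ∧ ∀ r : ℝ, 0 < r → r < r₀ →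
      ∀ θ ∈ Set.Icc (0 : ℝ) (2 * π),
        ‖f (r * Real.cos θ, r * Real.sin θ)
            - (r : ℂ) ^ N * (A * (Real.cos (N * θ) : ℂ) + B * (Real.sin (N * θ) : ℂ))‖
          ≤ ε * r ^ N) :
    ∀ θ : ℝ, A * (Real.cos (N * θ) : ℂ) + B * (Real.sin (N * θ) : ℂ) = 0 := by
  have hU : IsOpen (Metric.ball (0 : ℝ × ℝ) δ) := Metric.isOpen_ball
  have hU0 : Metric.ball (0 : ℝ × ℝ) δ ∈ 𝓝 0 := Metric.ball_mem_nhds 0 hδ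
  have hc := isWirtingerFamily_iterate hU hw
  set c := wirtingerIterate w
  have hF := (hc.shift 1 1).add_const_mul hc ((k : ℂ) ^ 2)
  have hFf : ∀ x ∈ Metric.ball (0 : ℝ × ℝ) δ, c 1 1 x + (k : ℂ) ^ 2 * c 0 0 x = f x := by
    intro x hx
    rw [← heq x hx, show c 1 1 = wirtinger (-I) (wirtinger I w) from rfl,
      wirtinger_wirtinger (hw x hx), laplacian2]
    change _ + (k : ℂ) ^ 2 * w x = _
    linear_combination (-fderiv ℝ (fun y => fderiv ℝ w y (0, 1)) x (0, 1)) * Complex.I_sq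
  -- the boundary relations
  have hray : ∀ s : ℝ, (∀ t : ℝ, 0 ≤ t → t < δ → (t * Real.cos θ₀, t * s) ∈ cornerRays δ θ₀) →
      ∀ n, (∑ ij ∈ antidiagonal n, (n.choose ij.1 : ℂ) * (((Real.cos θ₀ + s * I) / 2) ^ ij.1
        * ((Real.cos θ₀ - s * I) / 2) ^ ij.2 * c (ij.1 + 1) ij.2 0) = 0) ∧
      (∑ ij ∈ antidiagonal n, (n.choose ij.1 : ℂ) * (((Real.cos θ₀ + s * I) / 2) ^ ij.1
        * ((Real.cos θ₀ - s * I) / 2) ^ ij.2 * c ij.1 (ij.2 + 1) 0) = 0) := by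
    intro s hs n
    have hvanish : ∀ σ : ℂ, (fun t : ℝ => wirtinger σ w (t * Real.cos θ₀, t * s)
        - (t : ℂ) ^ n * 0) =o[𝓝[>] 0] fun t : ℝ => t ^ n := by
      intro σ
      refine isLittleO_of_forall_bound fun ε hε => ⟨δ, hδ, fun r hr hr' => ?_⟩
      simp only [wirtinger, (hbc _ (hs r hr.le hr')).2]
      simp only [zero_apply, mul_zero, add_zero, sub_zero, norm_zero]
      positivity
    have h1 := (hc.shift 1 0).lineSum_zero hU0 (Real.cos θ₀) s n 0 (hvanish (-I)) le_rfl
    have h2 := (hc.shift 0 1).lineSum_zero hU0 (Real.cos θ₀) s n 0 (hvanish I) le_rfl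
    rw [if_pos rfl, mul_zero] at h1 h2
    exact ⟨h1, h2⟩
  have hray₁ := hray (Real.sin θ₀) fun t h0 h1 => Or.inl ⟨t, h0, h1, rfl⟩
  have hray₂ := hray (-Real.sin θ₀) fun t h0 h1 => Or.inr ⟨t, h0, h1, by rw [mul_neg]⟩
  simp only [Complex.ofReal_neg, neg_mul, sub_neg_eq_add, ← sub_eq_add_neg] at hray₂
  have h00 : c 0 0 0 = 0 := (hbc 0 (Or.inl ⟨0, le_rfl, hδ, by simp [Prod.zero_eq_mk]⟩)).1
  have hexp : (Real.cos θ₀ + Real.sin θ₀ * I : ℂ) = Complex.exp (θ₀ * I) := by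
    simp [Complex.exp_mul_I]
  have hexp' : (Real.cos θ₀ - Real.sin θ₀ * I : ℂ) = Complex.exp (-(θ₀ * I)) := by
    rw [← neg_mul, Complex.exp_mul_I]; simp [sub_eq_add_neg]
  -- the coefficients of `f`
  have hfcoeff : ∀ θ : ℝ, ∀ n ≤ N, ∑ ij ∈ antidiagonal n, (n.choose ij.1 : ℂ) *
      (((Real.cos θ + Real.sin θ * I) / 2) ^ ij.1 * ((Real.cos θ - Real.sin θ * I) / 2) ^ ij.2
        * (c (ij.1 + 1) (ij.2 + 1) 0 + (k : ℂ) ^ 2 * c ij.1 ij.2 0)) =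
      if n = N then (N.factorial : ℂ) *
        (A * (Real.cos (N * θ) : ℂ) + B * (Real.sin (N * θ) : ℂ)) else 0 := by
    intro θ n hn
    obtain ⟨θ', hθ', hcos, hsin⟩ : ∃ θ' ∈ Set.Icc (0 : ℝ) (2 * π),
        Real.cos θ = Real.cos θ' ∧ Real.sin θ = Real.sin θ' := by
      obtain ⟨m, hm, -⟩ := existsUnique_add_zsmul_mem_Ico Real.two_pi_pos θ 0
      rw [zero_add, zsmul_eq_mul] at hm
      exact ⟨_, Set.Ico_subset_Icc_self hm, (Real.cos_add_int_mul_two_pi θ m).symm,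
        (Real.sin_add_int_mul_two_pi θ m).symm⟩
    rw [cos_sin_nat_mul_eq, hcos, hsin, ← cos_sin_nat_mul_eq]
    refine hF.lineSum_zero hU0 (Real.cos θ') (Real.sin θ') N _
      (isLittleO_of_forall_bound fun ε hε => ?_) hn
    obtain ⟨r₀, hr₀, hr⟩ := hasym ε hε
    refine ⟨min r₀ δ, lt_min hr₀ hδ, fun r hr1 hr2 => ?_⟩
    have hmem : (r * Real.cos θ', r * Real.sin θ') ∈ Metric.ball (0 : ℝ × ℝ) δ := by
      rw [mem_ball_zero_iff, Prod.norm_def, max_lt_iff]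
      have hle : ∀ s : ℝ, |s| ≤ 1 → ‖r * s‖ < δ := fun s hs => by
        rw [Real.norm_eq_abs, abs_mul, abs_of_pos hr1]
        exact (mul_le_of_le_one_right hr1.le hs).trans_lt (hr2.trans_le (min_le_right _ _))
      exact ⟨hle _ (Real.abs_cos_le_one _), hle _ (Real.abs_sin_le_one _)⟩
    rw [zero_add, hFf _ hmem]
    exact hr r hr1 (hr2.trans_le (min_le_left _ _)) θ' hθ'
  have hlow : ∀ a b, a + b < N → c (a + 1) (b + 1) 0 + (k : ℂ) ^ 2 * c a b 0 = 0 := by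
    intro a b hab
    have := trig_coeff_eq_zero (n := a + b) (v := fun i => ((a + b).choose i : ℂ) / 2 ^ (a + b) *
      (c (i + 1) (a + b - i + 1) 0 + (k : ℂ) ^ 2 * c i (a + b - i) 0)) (fun θ => by
        have h := hfcoeff θ (a + b) hab.le
        rw [if_neg hab.ne] at h
        rw [← h]
        refine sum_congr rfl fun ij hij => ?_
        rw [HasAntidiagonal.mem_antidiagonal] at hij
        rw [← hij, Nat.add_sub_cancel_left, div_pow, div_pow, pow_add]
        field_simp) (Nat.le_add_right a b)
    have hch : ((a + b).choose a : ℂ) ≠ 0 :=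
      Nat.cast_ne_zero.2 (Nat.choose_pos (Nat.le_add_right a b)).ne'
    simpa [hch] using this
  have hmid : ∀ a b, a + b = N → a ≠ 0 → b ≠ 0 →
      c (a + 1) (b + 1) 0 + (k : ℂ) ^ 2 * c a b 0 = 0 := by
    rintro a b rfl ha hb
    have := trig_coeff_eq_zero (n := a + b) (v := fun i => ((a + b).choose i : ℂ) / 2 ^ (a + b) *
      (c (i + 1) (a + b - i + 1) 0 + (k : ℂ) ^ 2 * c i (a + b - i) 0)
      - (a + b).factorial * ((if i = a + b then (A - B * I) / 2 else 0)
        + (if i = 0 then (A + B * I) / 2 else 0))) (fun θ => by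
        have h := hfcoeff θ (a + b) le_rfl
        rw [if_pos rfl, cos_sin_nat_mul_eq] at h
        simp only [sub_mul, sum_sub_distrib]
        rw [sub_eq_zero]
        refine Eq.trans ?_ (h.trans ?_)
        · refine sum_congr rfl fun ij hij => ?_
          rw [HasAntidiagonal.mem_antidiagonal] at hij
          rw [← hij, Nat.add_sub_cancel_left, div_pow, div_pow, pow_add]
          field_simp
        · simp only [mul_assoc, ← mul_sum, add_mul, sum_add_distrib]
          rw [sum_eq_single (a + b, 0), sum_eq_single (0, a + b)]
          · simp
          · rintro ⟨i, j⟩ hij hne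
            rw [HasAntidiagonal.mem_antidiagonal] at hij
            rw [if_neg (fun h : i = 0 => hne (by simp_all)), zero_mul]
          · simp
          · rintro ⟨i, j⟩ hij hne
            rw [HasAntidiagonal.mem_antidiagonal] at hij
            rw [if_neg (fun h : i = a + b => hne (by simp_all)), zero_mul]
          · simp) (Nat.le_add_right a b)
    have hch : ((a + b).choose a : ℂ) ≠ 0 :=
      Nat.cast_ne_zero.2 (Nat.choose_pos (Nat.le_add_right a b)).ne'
    simpa [hch, ha, hb] using this
  have hzero := low_coeff_eq_zero (c := fun a b => c a b 0)
    (hexp ▸ Complex.exp_ne_zero _) (hexp' ▸ Complex.exp_ne_zero _) h00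
    (fun n => (hray₁ n).1) (fun n => (hray₁ n).2) hlow
  have htop : ∀ a b, a + b = N → c (a + 1) (b + 1) 0 = 0 := fun a b hab =>
    top_coeff_eq_zero (c := fun a b => c a b 0) hθ₀ hθ₀' (fun a b h ha hb => by
      have := hmid a b h ha hb
      rwa [hzero N (by lia) a b h, mul_zero, add_zero] at this)
      hexp hexp' (hray₁ _).1 (hray₂ _).1 (hray₁ _).2 (hray₂ _).2 hab
  intro θ
  have h := hfcoeff θ N le_rfl
  rw [if_pos rfl, sum_eq_zero] at h
  · exact (mul_eq_zero.1 h.symm).resolve_left (Nat.cast_ne_zero.2 N.factorial_ne_zero)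
  · intro ij hij
    rw [HasAntidiagonal.mem_antidiagonal] at hij
    rw [htop _ _ hij, hzero N (by lia) _ _ hij]
    simp
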